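/- A representation π : A → L†(V) is integrable (π̄(a†) = π̄(a)* for all a ∈ A) if and only if π̄(s) is surjective for every s in the multiplicative set S generated by { 1+a†a : a ∈ A }. -/

import Mathlib

noncomputable section

local notation "⟪" x ", " y "⟫" => @inner ℂ _ _ x y

/-- `b` is a formal adjoint of `a` on the dense subspace `V` (membership in `L†(V)`). -/
def FormalAdjointOn {H : Type*} [NormedAddCommGroup H] [InnerProductSpace ℂ H]
    (V : Submodule ℂ H) (a b : V →ₗ[ℂ] V) : Prop :=
  ∀ u v : V, ⟪(a u : H), (v : H)⟫ = ⟪(u : H), (b v : H)⟫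

/-- The element `a ∈ L†(V)` viewed as a partially defined operator on `H`. -/
def opOf {H : Type*} [NormedAddCommGroup H] [InnerProductSpace ℂ H]
    (V : Submodule ℂ H) (a : V →ₗ[ℂ] V) : H →ₗ.[ℂ] H :=
  { domain := V, toFun := V.subtype.comp a }

/-- The graph of the composition `A ∘ B` on its natural domain `B⁻¹(dom A)`,
as a submodule of `H × H`. -/
def compGraph {H : Type*} [NormedAddCommGroup H] [InnerProductSpace ℂ H]
    (A B : H →ₗ.[ℂ] H) : Submodule ℂ (H × H) :=
  Submodule.map ((LinearMap.fst ℂ H H).prodMap (LinearMap.snd ℂ H H))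
    ((B.graph.prod A.graph) ⊓ LinearMap.ker
      (((LinearMap.snd ℂ H H).comp (LinearMap.fst ℂ (H × H) (H × H))) -
       ((LinearMap.fst ℂ H H).comp (LinearMap.snd ℂ (H × H) (H × H)))))

/-- The composition of two partially defined operators, on its natural domain. -/
def pcomp {H : Type*} [NormedAddCommGroup H] [InnerProductSpace ℂ H]
    (A B : H →ₗ.[ℂ] H) : H →ₗ.[ℂ] H :=
  (compGraph A B).toLinearPMap

/-- The operator `1 + A*A` on its natural domain `dom(A*A) = A⁻¹(dom A*)`. -/
def onePlusAdjSelf {H : Type*} [NormedAddCommGroup H] [InnerProductSpace ℂ H]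
    [CompleteSpace H] (A : H →ₗ.[ℂ] H) : H →ₗ.[ℂ] H :=
  (LinearMap.id.toPMap (⊤ : Submodule ℂ H)) + pcomp A.adjoint A

/-- Composition (on natural domains) of a finite list of partially defined
operators, the rightmost acting first. -/
def pcompList {H : Type*} [NormedAddCommGroup H] [InnerProductSpace ℂ H] :
    List (H →ₗ.[ℂ] H) → (H →ₗ.[ℂ] H)
  | [] => LinearMap.id.toPMap (⊤ : Submodule ℂ H)
  | T :: Ts => pcomp T (pcompList Ts)

/-- Surjectivity of a partially defined operator. -/
def PSurj {H : Type*} [NormedAddCommGroup H] [InnerProductSpace ℂ H]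
    (T : H →ₗ.[ℂ] H) : Prop :=
  ∀ ξ : H, ∃ x : T.domain, T x = ξ

/-- A representation `π : 𝒜 → L†(V)` of a unital `*`-algebra `𝒜` on a dense invariant
domain `V ⊆ H`: a unital algebra morphism into linear maps `V → V` such that
`π(star x)` is a formal adjoint of `π(x)`. -/
structure RepOn (𝒜 : Type*) [Ring 𝒜] [Algebra ℂ 𝒜] [StarRing 𝒜]
    {H : Type*} [NormedAddCommGroup H] [InnerProductSpace ℂ H]
    (V : Submodule ℂ H) where
  toFun : 𝒜 → (V →ₗ[ℂ] V)
  map_one' : toFun 1 = LinearMap.id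
  map_add' : ∀ x y, toFun (x + y) = toFun x + toFun y
  map_smul' : ∀ (c : ℂ) (x : 𝒜), toFun (c • x) = c • toFun x
  map_mul' : ∀ x y, toFun (x * y) = (toFun x).comp (toFun y)
  star_compat' : ∀ x, FormalAdjointOn V (toFun x) (toFun (star x))

/-- `π̄(x)`, the closure of `π(x)`. -/
def repClosure {𝒜 : Type*} [Ring 𝒜] [Algebra ℂ 𝒜] [StarRing 𝒜]
    {H : Type*} [NormedAddCommGroup H] [InnerProductSpace ℂ H]
    {V : Submodule ℂ H} (π : RepOn 𝒜 V) (x : 𝒜) : H →ₗ.[ℂ] H :=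
  (opOf V (π.toFun x)).closure

section FormalAdjoint

variable {H : Type*} [NormedAddCommGroup H] [InnerProductSpace ℂ H]
  {V : Submodule ℂ H} {a b : V →ₗ[ℂ] V}

theorem FormalAdjointOn.symm (h : FormalAdjointOn V a b) : FormalAdjointOn V b a := by
  intro u v
  rw [← inner_conj_symm, ← h v u, inner_conj_symm]

theorem mem_graph_opOf {p : H × H} :
    p ∈ (opOf V a).graph ↔ ∃ v : V, (v : H) = p.1 ∧ (a v : H) = p.2 :=
  LinearPMap.mem_graph_iff _

theorem mk_mem_closure_graph_opOf (v : V) :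
    ((v : H), (a v : H)) ∈ (opOf V a).closure.graph :=
  LinearPMap.le_graph_of_le (LinearPMap.le_closure _) (mem_graph_opOf.2 ⟨v, rfl, rfl⟩)

theorem closure_graph_opOf_induction (hc : (opOf V a).IsClosable) {P : H × H → Prop}
    (hP : IsClosed {p | P p}) (hv : ∀ v : V, P (v, a v)) {p : H × H}
    (hp : p ∈ (opOf V a).closure.graph) : P p := by
  rw [← hc.graph_closure_eq_closure_graph] at hp
  refine closure_minimal (fun q hq => ?_) hP hp
  obtain ⟨v, h1, h2⟩ := mem_graph_opOf.1 hq
  have := hv v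
  rwa [h1, h2] at this

theorem psurj_iff_graph {T : H →ₗ.[ℂ] H} : PSurj T ↔ ∀ y : H, ∃ x : H, (x, y) ∈ T.graph := by
  refine forall_congr' fun y => ⟨fun ⟨x, hx⟩ => ⟨x, ?_⟩, fun ⟨x, hx⟩ => ?_⟩
  · exact (LinearPMap.mem_graph_iff _).2 ⟨x, rfl, hx⟩
  · obtain ⟨z, -, hz⟩ := (LinearPMap.mem_graph_iff _).1 hx
    exact ⟨z, hz⟩

/-- The range of an operator with surjective closure has trivial orthogonal complement. -/
theorem eq_zero_of_psurj_closure (hc : (opOf V a).IsClosable) (hs : PSurj (opOf V a).closure)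
    {ξ : H} (hξ : ∀ v : V, ⟪(a v : H), ξ⟫ = 0) : ξ = 0 := by
  obtain ⟨x, hx⟩ := psurj_iff_graph.1 hs ξ
  have : ⟪ξ, ξ⟫ = 0 :=
    closure_graph_opOf_induction (P := fun p => ⟪p.2, ξ⟫ = 0) hc
      (isClosed_eq (by fun_prop) continuous_const) hξ hx
  exact inner_self_eq_zero.1 this

variable [CompleteSpace H]

theorem mem_adjoint_graph_opOf (hV : Dense (V : Set H)) {p : H × H} :
    p ∈ (opOf V a).adjoint.graph ↔ ∀ v : V, ⟪(a v : H), p.1⟫ = ⟪(v : H), p.2⟫ := by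
  rw [LinearPMap.adjoint_graph_eq_graph_adjoint (T := opOf V a) hV, Submodule.mem_adjoint_iff]
  constructor
  · intro h v
    exact sub_eq_zero.1 (h _ _ (mem_graph_opOf.2 ⟨v, rfl, rfl⟩))
  · intro h x y hxy
    obtain ⟨v, rfl, rfl⟩ := mem_graph_opOf.1 hxy
    exact sub_eq_zero.2 (h v)

theorem FormalAdjointOn.opOf_le_adjoint (hV : Dense (V : Set H)) (h : FormalAdjointOn V a b) :
    opOf V b ≤ (opOf V a).adjoint :=
  LinearPMap.IsFormalAdjoint.le_adjoint (T := opOf V a) hV h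

theorem FormalAdjointOn.isClosable (hV : Dense (V : Set H)) (h : FormalAdjointOn V a b) :
    (opOf V b).IsClosable :=
  LinearPMap.isClosable_iff_exists_closed_extension.2
    ⟨_, LinearPMap.adjoint_isClosed (T := opOf V a) hV, h.opOf_le_adjoint hV⟩

theorem FormalAdjointOn.closure_graph_le (hV : Dense (V : Set H)) (h : FormalAdjointOn V a b) :
    (opOf V b).closure.graph ≤ (opOf V a).adjoint.graph := fun _ hp =>
  closure_graph_opOf_induction (h.isClosable hV)
    (LinearPMap.adjoint_isClosed (T := opOf V a) hV)
    (fun v => (mem_adjoint_graph_opOf hV).2 fun u => h u v) hp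

theorem adjoint_closure_opOf (hV : Dense (V : Set H)) (hc : (opOf V a).IsClosable) :
    (opOf V a).closure.adjoint = (opOf V a).adjoint := by
  have hd : Dense ((opOf V a).closure.domain : Set H) :=
    hV.mono (LinearPMap.le_closure (opOf V a)).1
  refine LinearPMap.eq_of_eq_graph (Submodule.ext fun p => ?_)
  rw [LinearPMap.adjoint_graph_eq_graph_adjoint hd, Submodule.mem_adjoint_iff,
    mem_adjoint_graph_opOf hV]
  constructor
  · intro h v
    exact sub_eq_zero.1 (h _ _ (mk_mem_closure_graph_opOf v))
  · intro h x y hxy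
    exact closure_graph_opOf_induction (P := fun q => ⟪q.2, p.1⟫ - ⟪q.1, p.2⟫ = 0) hc
      (isClosed_eq (by fun_prop) continuous_const) (fun v => sub_eq_zero.2 (h v)) hxy

/-- If the range of `1 + ab` has trivial orthogonal complement, then `V` is a core for `a*`. -/
theorem FormalAdjointOn.closure_eq_adjoint (hV : Dense (V : Set H)) (h : FormalAdjointOn V a b)
    (hr : ∀ ξ : H, (∀ v : V, ⟪(v : H) + (a (b v) : H), ξ⟫ = 0) → ξ = 0) :
    (opOf V b).closure = (opOf V a).adjoint := by
  refine LinearPMap.eq_of_eq_graph (le_antisymm (h.closure_graph_le hV) fun p hp => ?_)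
  set K : Submodule ℂ (WithLp 2 (H × H)) :=
    (opOf V b).closure.graph.comap (WithLp.linearEquiv 2 ℂ (H × H)).toLinearMap
  have hKc : IsClosed (K : Set (WithLp 2 (H × H))) :=
    (h.isClosable hV).closure_isClosed.preimage (WithLp.prod_continuous_ofLp 2 H H)
  have : CompleteSpace K := hKc.completeSpace_coe
  obtain ⟨k, hk, q, hq, hkq⟩ := K.exists_add_mem_mem_orthogonal (WithLp.toLp 2 p)
  have hkG : WithLp.ofLp k ∈ (opOf V b).closure.graph := hk
  have hp_eq : p = WithLp.ofLp k + WithLp.ofLp q := congrArg WithLp.ofLp hkq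
  have hqa : WithLp.ofLp q ∈ (opOf V a).adjoint.graph := by
    rw [eq_sub_of_add_eq' hp_eq.symm]
    exact Submodule.sub_mem _ hp (h.closure_graph_le hV hkG)
  have hq1 : (WithLp.ofLp q).1 = 0 := by
    refine hr _ fun v => ?_
    have ho : inner ℂ (WithLp.toLp 2 ((v : H), (b v : H))) q = 0 :=
      (Submodule.mem_orthogonal K q).1 hq _ (mk_mem_closure_graph_opOf (a := b) v)
    rw [WithLp.prod_inner_apply] at ho
    rw [inner_add_left, (mem_adjoint_graph_opOf hV).1 hqa (b v)]
    exact ho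
  have hq2 : (WithLp.ofLp q).2 = 0 := LinearPMap.graph_fst_eq_zero_snd _ hqa hq1
  have hq0 : WithLp.ofLp q = 0 := Prod.ext hq1 hq2
  rw [hp_eq, hq0, add_zero]
  exact hkG

/-- An operator bounded below by `1` whose range has trivial orthogonal complement has
surjective closure. -/
theorem psurj_closure_of_norm_le (hc : (opOf V a).IsClosable)
    (hb : ∀ v : V, ‖(v : H)‖ ≤ ‖(a v : H)‖)
    (hr : ∀ ξ : H, (∀ v : V, ⟪(a v : H), ξ⟫ = 0) → ξ = 0) :
    PSurj (opOf V a).closure := by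
  set G := (opOf V a).closure.graph
  have hGb : ∀ p ∈ G, ‖p.1‖ ≤ ‖p.2‖ := fun p hp =>
    closure_graph_opOf_induction (P := fun p => ‖p.1‖ ≤ ‖p.2‖) hc
      (isClosed_le (by fun_prop) (by fun_prop)) hb hp
  have : CompleteSpace G := IsClosed.completeSpace_coe (s := (G : Set (H × H)))
    (hs := hc.closure_isClosed)
  let f : G →L[ℂ] H := (ContinuousLinearMap.snd ℂ H H).comp G.subtypeL
  have hf : AntilipschitzWith 1 f :=
    AddMonoidHomClass.antilipschitz_of_bound f fun p => by
      rw [NNReal.coe_one, one_mul]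
      exact max_le (hGb p p.2) le_rfl
  have hcl : IsClosed (f.range : Set H) := by
    rw [LinearMap.coe_range]
    exact hf.isClosed_range f.uniformContinuous
  have : CompleteSpace f.range := hcl.completeSpace_coe
  have htop : f.range = ⊤ := by
    rw [← Submodule.orthogonal_eq_bot_iff, Submodule.eq_bot_iff]
    intro ξ hξ
    exact hr ξ fun v =>
      (Submodule.mem_orthogonal _ ξ).1 hξ _ ⟨⟨_, mk_mem_closure_graph_opOf v⟩, rfl⟩
  refine psurj_iff_graph.2 fun y => ?_
  obtain ⟨⟨p, hp⟩, rfl⟩ : y ∈ f.range := htop ▸ Submodule.mem_top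
  exact ⟨p.1, hp⟩

end FormalAdjoint

theorem star_mem_closure_one_add_star_mul_self {𝒜 : Type*} [Ring 𝒜] [StarRing 𝒜] {s : 𝒜}
    (hs : s ∈ Submonoid.closure { x : 𝒜 | ∃ a : 𝒜, x = 1 + star a * a }) :
    star s ∈ Submonoid.closure { x : 𝒜 | ∃ a : 𝒜, x = 1 + star a * a } := by
  induction hs using Submonoid.closure_induction with
  | mem x hx =>
    obtain ⟨a, rfl⟩ := hx
    exact Submonoid.subset_closure ⟨a, by simp⟩
  | one => simp
  | mul x y _ _ hx hy =>
    rw [star_mul]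
    exact mul_mem hy hx

namespace RepOn

variable {𝒜 : Type*} [Ring 𝒜] [Algebra ℂ 𝒜] [StarRing 𝒜]
  {H : Type*} [NormedAddCommGroup H] [InnerProductSpace ℂ H]
  {V : Submodule ℂ H} (π : RepOn 𝒜 V)

theorem one_add_mul_apply (x y : 𝒜) (v : V) :
    π.toFun (1 + x * y) v = v + π.toFun x (π.toFun y v) := by
  rw [π.map_add', π.map_one', π.map_mul']
  rfl

theorem norm_le_one_add_star_mul_self_apply (x : 𝒜) (v : V) :
    ‖(v : H)‖ ≤ ‖(π.toFun (1 + star x * x) v : H)‖ := by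
  rcases eq_or_ne (v : H) 0 with h0 | h0
  · rw [h0, norm_zero]
    exact norm_nonneg _
  have hin : ⟪(v : H), (π.toFun (1 + star x * x) v : H)⟫ =
      ⟪(v : H), (v : H)⟫ + ⟪(π.toFun x v : H), (π.toFun x v : H)⟫ := by
    rw [one_add_mul_apply, Submodule.coe_add, inner_add_right, ← π.star_compat']
  have hre := congrArg Complex.re hin
  rw [Complex.add_re] at hre
  have h1 : (⟪(v : H), (v : H)⟫).re = ‖(v : H)‖ ^ 2 := inner_self_eq_norm_sq (𝕜 := ℂ) _
  have h2 : 0 ≤ (⟪(π.toFun x v : H), (π.toFun x v : H)⟫).re := inner_self_nonneg (𝕜 := ℂ)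
  have h3 := (Complex.re_le_norm _).trans
    (norm_inner_le_norm (𝕜 := ℂ) (v : H) (π.toFun (1 + star x * x) v : H))
  have h4 : 0 < ‖(v : H)‖ := norm_pos_iff.2 h0
  refine le_of_mul_le_mul_left ?_ h4
  linarith [sq ‖(v : H)‖]

theorem norm_le_of_mem_closure {s : 𝒜}
    (hs : s ∈ Submonoid.closure { x : 𝒜 | ∃ a : 𝒜, x = 1 + star a * a }) (v : V) :
    ‖(v : H)‖ ≤ ‖(π.toFun s v : H)‖ := by
  induction hs using Submonoid.closure_induction generalizing v with
  | mem x hx =>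
    obtain ⟨a, rfl⟩ := hx
    exact π.norm_le_one_add_star_mul_self_apply a v
  | one => rw [π.map_one', LinearMap.id_apply]
  | mul x y _ _ hx hy =>
    rw [π.map_mul']
    exact (hy v).trans (hx _)

theorem isClosable [CompleteSpace H] (hV : Dense (V : Set H)) (x : 𝒜) :
    (opOf V (π.toFun x)).IsClosable :=
  (π.star_compat' x).symm.isClosable hV

end RepOn

/-- A representation `π : 𝒜 → L†(V)` is integrable
(`π̄(a†) = π̄(a)*` for all `a ∈ 𝒜`) if and only if `π̄(s)` is surjective for every `s`
in the multiplicative set `S` generated by `{ 1 + a†a : a ∈ 𝒜 }`. -/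
theorem integrable_iff_closure_surjective
    {𝒜 : Type*} [Ring 𝒜] [Algebra ℂ 𝒜] [StarRing 𝒜] [StarModule ℂ 𝒜]
    {H : Type*} [NormedAddCommGroup H] [InnerProductSpace ℂ H] [CompleteSpace H]
    (V : Submodule ℂ H) (hV : Dense (V : Set H))
    (π : RepOn 𝒜 V) :
    (∀ a : 𝒜, repClosure π (star a) = (repClosure π a).adjoint) ↔
    (∀ s ∈ Submonoid.closure { x : 𝒜 | ∃ a : 𝒜, x = 1 + star a * a },
      PSurj (repClosure π s)) := by
  constructor
  · intro hint s hs
    refine psurj_closure_of_norm_le (π.isClosable hV s) (π.norm_le_of_mem_closure hs) fun ξ hξ => ?_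
    have hmem : (ξ, (0 : H)) ∈ (repClosure π (star s)).graph := by
      rw [hint s, repClosure, adjoint_closure_opOf hV (π.isClosable hV s),
        mem_adjoint_graph_opOf hV]
      intro v
      rw [hξ v, inner_zero_right]
    have hle : ‖ξ‖ ≤ ‖(0 : H)‖ :=
      closure_graph_opOf_induction (P := fun p => ‖p.1‖ ≤ ‖p.2‖) (π.isClosable hV (star s))
        (isClosed_le (by fun_prop) (by fun_prop))
        (π.norm_le_of_mem_closure (star_mem_closure_one_add_star_mul_self hs)) hmem
    exact norm_le_zero_iff.1 (hle.trans_eq norm_zero)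
  · intro hsurj x
    rw [repClosure, repClosure, adjoint_closure_opOf hV (π.isClosable hV x)]
    refine (π.star_compat' x).closure_eq_adjoint hV fun ξ hξ => ?_
    refine eq_zero_of_psurj_closure (π.isClosable hV (1 + x * star x))
      (hsurj _ (Submonoid.subset_closure ⟨star x, by rw [star_star]⟩)) fun v => ?_
    rw [π.one_add_mul_apply]
    exact hξ v
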